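/- Let γ be a geodesic in a Cartan–Hadamard manifold with sectional curvature −4 ≤ κ ≤ −1. Then for any t₀ ∈ ℝ and any T ≥ (1/2) log 2, the gradients of the two Busemann functions satisfy ⟨∇f_γ(p), ∇f_{−γ}(p)⟩ > 0 for all p on the horosphere {f_γ = −t₀ + T} lying outside the horoball {f_{−γ} ≤ t₀ + T}. -/

import Mathlib

open Filter Metric

noncomputable section

variable {M : Type*}

/-- A unit-speed geodesic line in a metric space: an isometric embedding of `ℝ`. -/
def IsUnitSpeedGeodesic [MetricSpace M] (c : ℝ → M) : Prop :=
  ∀ s t : ℝ, dist (c s) (c t) = |s - t|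

/-- The Busemann function of `γ`:
`f_γ(p) = lim_{t→∞} (dist(p, γ(t)) − t)`.  For a unit-speed geodesic line the
function `t ↦ dist(p, γ(t)) − t` is nonincreasing and bounded below, so the
limit coincides with the infimum, which we take as the definition. -/
noncomputable def busemannF [MetricSpace M] (γ : ℝ → M) (p : M) : ℝ :=
  ⨅ t : ℝ, (dist p (γ t) - t)

/-- The metric space `M` is a Hadamard (Cartan–Hadamard) space: complete,
geodesic, with globally convex distance function (Busemann nonpositive
curvature); in a Cartan–Hadamard manifold every geodesic segment extends
to a line, which is reflected in the statement of `geod`. -/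
structure IsHadamard (M : Type*) [MetricSpace M] : Prop where
  complete : CompleteSpace M
  proper : ProperSpace M
  geod : ∀ x y : M, ∃ c : ℝ → M, IsUnitSpeedGeodesic c ∧ c 0 = x ∧ c (dist x y) = y
  convex : ∀ c₁ c₂ : ℝ → M, IsUnitSpeedGeodesic c₁ → IsUnitSpeedGeodesic c₂ →
    ConvexOn ℝ Set.univ fun t => dist (c₁ t) (c₂ t)

/-- Comparison encoding of the sectional curvature upper bound `κ ≤ −1`:
at a foot point `c s` of `p` on a geodesic line `c`, the Busemann functions of
`c` and of its reversal satisfy the real-hyperbolic comparison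
`f_c(p) ≥ −s + log cosh d`, `f_{−c}(p) ≥ s + log cosh d`, where
`d = dist(p, c(s))` (equality holds in constant curvature `−1`). -/
def SecLEneg1 (M : Type*) [MetricSpace M] : Prop :=
  ∀ c : ℝ → M, IsUnitSpeedGeodesic c → ∀ p : M, ∀ s : ℝ,
    dist p (c s) = Metric.infDist p (Set.range c) →
      (-s + Real.log (Real.cosh (dist p (c s))) ≤ busemannF c p ∧
       s + Real.log (Real.cosh (dist p (c s))) ≤ busemannF (fun t => c (-t)) p)

/-- Comparison encoding of the sectional curvature lower bound `κ ≥ −4`: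
the reversed inequalities against the model of constant curvature `−4`,
where the comparison function is `(1/2) log cosh (2d)`. -/
def SecGEneg4 (M : Type*) [MetricSpace M] : Prop :=
  ∀ c : ℝ → M, IsUnitSpeedGeodesic c → ∀ p : M, ∀ s : ℝ,
    dist p (c s) = Metric.infDist p (Set.range c) →
      (busemannF c p ≤ -s + (1 / 2) * Real.log (Real.cosh (2 * dist p (c s))) ∧
       busemannF (fun t => c (-t)) p ≤ s + (1 / 2) * Real.log (Real.cosh (2 * dist p (c s))))

open Topology

section RealConvex

lemma ConvexOn.differentiableAt_zero_of_add_neg_le {k : ℝ → ℝ} (hk : ConvexOn ℝ Set.univ k)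
    {C : ℝ} (h : ∀ s, k s + k (-s) ≤ 2 * k 0 + C * s ^ 2) : DifferentiableAt ℝ k 0 := by
  have h0 : (0 : ℝ) ∈ interior Set.univ := by simp
  have hr := hk.hasDerivWithinAt_rightDeriv_of_mem_interior h0
  have hl := hk.hasDerivWithinAt_leftDeriv_of_mem_interior h0
  have hle := hk.leftDeriv_le_rightDeriv_of_mem_interior h0
  set R := derivWithin k (Set.Ioi 0) 0
  set L := derivWithin k (Set.Iio 0) 0
  have key : ∀ s : ℝ, 0 < s → R - L ≤ C * s := by
    intro s hs
    have h1 := hk.rightDeriv_le_slope_of_mem_interior h0 (Set.mem_univ s) hs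
    have h2 := hk.slope_le_leftDeriv_of_mem_interior (Set.mem_univ (-s)) h0 (by linarith)
    rw [slope_def_field, le_div_iff₀ (by linarith)] at h1
    rw [slope_def_field, div_le_iff₀ (by linarith)] at h2
    have h3 := h s
    change R * (s - 0) ≤ _ at h1
    change _ ≤ L * (0 - -s) at h2
    have : (R - L) * s ≤ (C * s) * s := by nlinarith
    exact le_of_mul_le_mul_right this hs
  have hRL : R - L ≤ 0 := by
    have ht : Tendsto (fun s : ℝ => C * s) (𝓝[>] 0) (𝓝 (C * 0)) :=
      ((continuous_const.mul continuous_id).tendsto 0).mono_left nhdsWithin_le_nhds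
    rw [mul_zero] at ht
    exact ge_of_tendsto ht (eventually_nhdsWithin_of_forall fun s hs => key s hs)
  have hEq : L = R := le_antisymm hle (by linarith)
  rw [hEq] at hl
  have hu := hl.Iic_of_Iio.union hr.Ici_of_Ioi
  rw [Set.Iic_union_Ici, hasDerivWithinAt_univ] at hu
  exact hu.differentiableAt

lemma ConvexOn.add_mul_le_of_hasDerivAt_zero {k : ℝ → ℝ} (hk : ConvexOn ℝ Set.univ k) {D : ℝ}
    (h : HasDerivAt k D 0) (s : ℝ) : k 0 + D * s ≤ k s := by
  rcases lt_trichotomy s 0 with hs | rfl | hs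
  · have := hk.slope_le_of_hasDerivAt (Set.mem_univ s) (Set.mem_univ 0) hs h
    rw [slope_def_field, div_le_iff₀ (by linarith)] at this
    linarith
  · simp
  · have := hk.le_slope_of_hasDerivAt (Set.mem_univ 0) (Set.mem_univ s) hs h
    rw [slope_def_field, le_div_iff₀ (by linarith)] at this
    linarith

lemma ConvexOn.nonneg_of_neg_sq_le {k : ℝ → ℝ} (hk : ConvexOn ℝ Set.univ k) (h0 : k 0 = 0)
    {C : ℝ} (h : ∀ s, -(C * s ^ 2) ≤ k s) (s : ℝ) : 0 ≤ k s := by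
  have key : ∀ ε : ℝ, 0 < ε → ε ≤ 1 → -(C * s ^ 2) * ε ≤ k s := by
    intro ε hε hε1
    have h1 := hk.2 (Set.mem_univ 0) (Set.mem_univ s) (sub_nonneg.2 hε1) hε.le (by ring)
    simp only [smul_eq_mul, mul_zero, zero_add, h0] at h1
    have h2 := h (ε * s)
    have : (-(C * s ^ 2) * ε) * ε ≤ k s * ε := by nlinarith
    exact le_of_mul_le_mul_right this hε
  have ht : Tendsto (fun ε : ℝ => -(C * s ^ 2) * ε) (𝓝[>] 0) (𝓝 (-(C * s ^ 2) * 0)) :=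
    ((continuous_const.mul continuous_id).tendsto 0).mono_left nhdsWithin_le_nhds
  rw [mul_zero] at ht
  refine le_of_tendsto ht ?_
  filter_upwards [Ioc_mem_nhdsGT (zero_lt_one' ℝ)] with ε hε using key ε hε.1 hε.2

lemma log_cosh_le_half_sq (x : ℝ) : Real.log (Real.cosh x) ≤ x ^ 2 / 2 := by
  rw [Real.log_le_iff_le_exp (Real.cosh_pos x)]
  exact Real.cosh_le_exp_half_sq x

lemma log_cosh_pos {x : ℝ} (hx : x ≠ 0) : 0 < Real.log (Real.cosh x) :=
  Real.log_pos (Real.one_lt_cosh.2 hx)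

lemma sub_log_two_le_log_cosh (x : ℝ) : x - Real.log 2 ≤ Real.log (Real.cosh x) := by
  rw [Real.le_log_iff_exp_le (Real.cosh_pos x), Real.exp_sub, Real.exp_log two_pos, Real.cosh_eq]
  have := Real.exp_pos (-x)
  linarith

lemma continuous_log_cosh : Continuous fun x : ℝ => Real.log (Real.cosh x) :=
  Real.continuous_cosh.log fun x => (Real.cosh_pos x).ne'

end RealConvex

section Busemann

variable [MetricSpace M]

namespace IsUnitSpeedGeodesic

variable {γ c : ℝ → M}

lemma reverse (hγ : IsUnitSpeedGeodesic γ) : IsUnitSpeedGeodesic fun t => γ (-t) := by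
  intro s t
  rw [hγ, abs_sub_comm]
  congr 1
  ring

lemma shift (hγ : IsUnitSpeedGeodesic γ) (a : ℝ) : IsUnitSpeedGeodesic fun t => γ (a + t) := by
  intro s t
  rw [hγ]
  congr 1
  ring

lemma isometry (hγ : IsUnitSpeedGeodesic γ) : Isometry γ :=
  Isometry.of_dist_eq fun s t => by rw [hγ, Real.dist_eq]

lemma antitone_dist_sub (hγ : IsUnitSpeedGeodesic γ) (x : M) :
    Antitone fun t : ℝ => dist x (γ t) - t := by
  intro s t hst
  have h1 := dist_triangle x (γ s) (γ t)
  rw [hγ s t, abs_sub_comm, abs_of_nonneg (sub_nonneg.2 hst)] at h1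
  change dist x (γ t) - t ≤ dist x (γ s) - s
  linarith

lemma bddBelow_dist_sub (hγ : IsUnitSpeedGeodesic γ) (x : M) :
    BddBelow (Set.range fun t : ℝ => dist x (γ t) - t) := by
  refine ⟨-dist x (γ 0), ?_⟩
  rintro _ ⟨t, rfl⟩
  have h1 := dist_triangle (γ 0) x (γ t)
  rw [hγ, dist_comm (γ 0) x] at h1
  have := neg_abs_le (0 - t)
  change -dist x (γ 0) ≤ dist x (γ t) - t
  linarith

lemma busemannF_le (hγ : IsUnitSpeedGeodesic γ) (x : M) (t : ℝ) :
    busemannF γ x ≤ dist x (γ t) - t :=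
  ciInf_le (hγ.bddBelow_dist_sub x) t

lemma tendsto_busemannF (hγ : IsUnitSpeedGeodesic γ) (x : M) :
    Tendsto (fun t : ℝ => dist x (γ t) - t) atTop (𝓝 (busemannF γ x)) :=
  tendsto_atTop_ciInf (hγ.antitone_dist_sub x) (hγ.bddBelow_dist_sub x)

lemma tendsto_busemannF_nat (hγ : IsUnitSpeedGeodesic γ) (x : M) :
    Tendsto (fun n : ℕ => dist x (γ n) - n) (hyperfilter ℕ : Filter ℕ)
      (𝓝 (busemannF γ x)) :=
  ((hγ.tendsto_busemannF x).comp tendsto_natCast_atTop_atTop).mono_left Nat.hyperfilter_le_atTop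

lemma busemannF_le_add_dist (hγ : IsUnitSpeedGeodesic γ) (x y : M) :
    busemannF γ x ≤ busemannF γ y + dist x y := by
  refine le_of_tendsto_of_tendsto' (hγ.tendsto_busemannF x)
    ((hγ.tendsto_busemannF y).add_const (dist x y)) fun t => ?_
  have := dist_triangle x y (γ t)
  linarith

lemma continuous_busemannF (hγ : IsUnitSpeedGeodesic γ) : Continuous (busemannF γ) :=
  (LipschitzWith.of_le_add fun x y => hγ.busemannF_le_add_dist x y).continuous

lemma busemannF_add_reverse_nonneg (hγ : IsUnitSpeedGeodesic γ) (x : M) :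
    0 ≤ busemannF γ x + busemannF (fun t => γ (-t)) x := by
  refine ge_of_tendsto' ((hγ.tendsto_busemannF x).add (hγ.reverse.tendsto_busemannF x))
    fun t => ?_
  have h := dist_triangle_left (γ t) (γ (-t)) x
  rw [hγ] at h
  have := le_abs_self (t - -t)
  linarith

lemma exists_foot (hγ : IsUnitSpeedGeodesic γ) (x : M) :
    ∃ s, dist x (γ s) = infDist x (Set.range γ) := by
  have hc : IsClosed (Set.range γ) := hγ.isometry.isClosedEmbedding.isClosed_range
  have hcoer : Tendsto (fun t => dist x (γ t)) (cocompact ℝ) atTop := by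
    have h := tendsto_atTop_add_const_right _ (-dist x (γ 0)) (tendsto_norm_cocompact_atTop (E := ℝ))
    refine tendsto_atTop_mono (fun t => ?_) h
    have h1 := dist_triangle (γ t) x (γ 0)
    rw [hγ, dist_comm (γ t) x, sub_zero] at h1
    rw [Real.norm_eq_abs]
    linarith
  obtain ⟨s, hs⟩ := (continuous_const.dist hγ.isometry.continuous :
    Continuous fun t => dist x (γ t)).exists_forall_le hcoer
  refine ⟨s, le_antisymm ?_ (infDist_le_dist_of_mem (Set.mem_range_self s))⟩
  refine (le_infDist (Set.range_nonempty γ)).2 ?_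
  rintro _ ⟨t, rfl⟩
  exact hs t

lemma dist_eq_infDist_of_forall_le {x : M} {s : ℝ} (h : ∀ t, dist x (γ s) ≤ dist x (γ t)) :
    dist x (γ s) = infDist x (Set.range γ) := by
  refine le_antisymm ((le_infDist (Set.range_nonempty γ)).2 ?_)
    (infDist_le_dist_of_mem (Set.mem_range_self s))
  rintro _ ⟨t, rfl⟩
  exact h t

/-- Busemann functions are convex along geodesic lines. -/
lemma convexOn_busemannF (hM : IsHadamard M) (hγ : IsUnitSpeedGeodesic γ)
    (hc : IsUnitSpeedGeodesic c) : ConvexOn ℝ Set.univ fun s => busemannF γ (c s) := by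
  have hlim : ∀ s : ℝ, Tendsto (fun N : ℝ => dist (c s) (γ (N + s)) - N) atTop
      (𝓝 (busemannF γ (c s) + s)) := by
    intro s
    have h := ((hγ.tendsto_busemannF (c s)).comp (tendsto_atTop_add_const_right _ s tendsto_id)
      ).add_const s
    refine h.congr fun N => ?_
    simp only [Function.comp, id]
    ring
  refine ⟨convex_univ, fun x _ y _ a b ha hb hab => ?_⟩
  have h := le_of_tendsto_of_tendsto' (hlim (a • x + b • y))
    (((hlim x).const_mul a).add ((hlim y).const_mul b)) fun N => ?_
  · simp only [smul_eq_mul] at h ⊢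
    linarith
  · have := (hM.convex c _ hc (hγ.shift N)).2 (Set.mem_univ x) (Set.mem_univ y) ha hb hab
    simp only [smul_eq_mul] at this ⊢
    have hN : a * N + b * N = N := by rw [← add_mul, hab, one_mul]
    linarith

/-- A line along which `busemannF γ` decreases at unit speed supports `busemannF γ` from above. -/
lemma busemannF_le_of_asymptotic (hγ : IsUnitSpeedGeodesic γ) (hc : IsUnitSpeedGeodesic c)
    (h : ∀ t, busemannF γ (c t) = busemannF γ (c 0) - t) (x : M) :
    busemannF γ x ≤ busemannF γ (c 0) + busemannF c x := by
  refine ge_of_tendsto' ((hc.tendsto_busemannF x).const_add _) fun t => ?_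
  have := hγ.busemannF_le_add_dist x (c t)
  rw [h] at this
  linarith

lemma busemannF_add_reverse_le (hlower : SecGEneg4 M) (hγ : IsUnitSpeedGeodesic γ)
    (x : M) (t : ℝ) :
    busemannF γ x + busemannF (fun t => γ (-t)) x ≤ 2 * dist x (γ t) ^ 2 := by
  obtain ⟨s, hs⟩ := hγ.exists_foot x
  obtain ⟨h1, h2⟩ := hlower γ hγ x s hs
  have h3 := log_cosh_le_half_sq (2 * dist x (γ s))
  have h4 : dist x (γ s) ≤ dist x (γ t) := hs ▸ infDist_le_dist_of_mem (Set.mem_range_self t)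
  have h5 : dist x (γ s) ^ 2 ≤ dist x (γ t) ^ 2 := by gcongr
  nlinarith

end IsUnitSpeedGeodesic

lemma exists_limit_geodesic [ProperSpace M] {p : M} {l : ℕ → ℝ → M}
    (hl : ∀ n, IsUnitSpeedGeodesic (l n)) (h0 : ∀ n, l n 0 = p) :
    ∃ σ : ℝ → M, IsUnitSpeedGeodesic σ ∧ σ 0 = p ∧
      ∀ t, Tendsto (fun n => l n t) (hyperfilter ℕ : Filter ℕ) (𝓝 (σ t)) := by
  have hex : ∀ t, ∃ x, Tendsto (fun n => l n t) (hyperfilter ℕ : Filter ℕ) (𝓝 x) := by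
    intro t
    have hmem : closedBall p |t| ∈ (hyperfilter ℕ).map fun n => l n t := by
      refine Ultrafilter.mem_map.2 (Filter.univ_mem' fun n => ?_)
      change dist (l n t) p ≤ |t|
      rw [← h0 n, hl n, sub_zero]
    obtain ⟨x, -, hx⟩ := (isCompact_closedBall p |t|).ultrafilter_le_nhds' _ hmem
    exact ⟨x, hx⟩
  choose σ hσ using hex
  refine ⟨σ, fun s t => ?_, ?_, hσ⟩
  · refine tendsto_nhds_unique ((hσ s).dist (hσ t)) ?_
    simp only [hl _ s t]
    exact tendsto_const_nhds
  · refine tendsto_nhds_unique (hσ 0) ?_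
    simp only [h0]
    exact tendsto_const_nhds

/-- Lines through `p` and `γ n` subconverge to a line through `p` along which `busemannF γ`
decreases at unit speed. -/
lemma exists_asymptotic_line (hM : IsHadamard M) {γ : ℝ → M} (hγ : IsUnitSpeedGeodesic γ) (p : M) :
    ∃ (l : ℕ → ℝ → M) (σ : ℝ → M), (∀ n, IsUnitSpeedGeodesic (l n)) ∧ (∀ n, l n 0 = p) ∧
      (∀ n : ℕ, l n (dist p (γ n)) = γ n) ∧ IsUnitSpeedGeodesic σ ∧ σ 0 = p ∧
      (∀ t, Tendsto (fun n => l n t) (hyperfilter ℕ : Filter ℕ) (𝓝 (σ t))) ∧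
      ∀ t, busemannF γ (σ t) = busemannF γ p - t := by
  have := hM.proper
  choose l hl hl0 hl1 using fun n : ℕ => hM.geod p (γ n)
  obtain ⟨σ, hσ, hσ0, hlim⟩ := exists_limit_geodesic hl hl0
  refine ⟨l, σ, hl, hl0, hl1, hσ, hσ0, hlim, fun t => ?_⟩
  have hd : Tendsto (fun n => dist (l n t) (σ t)) (hyperfilter ℕ : Filter ℕ) (𝓝 0) :=
    tendsto_iff_dist_tendsto_zero.1 (hlim t)
  have hinf : Tendsto (fun n : ℕ => dist p (γ n)) (hyperfilter ℕ : Filter ℕ) atTop := by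
    refine tendsto_atTop_mono (fun n => ?_) (tendsto_atTop_add_const_left _ (busemannF γ p)
      (tendsto_natCast_atTop_atTop.mono_left Nat.hyperfilter_le_atTop))
    have := hγ.busemannF_le p n
    linarith
  have heq : ∀ᶠ n : ℕ in (hyperfilter ℕ : Filter ℕ), dist (l n t) (γ n) = dist p (γ n) - t := by
    filter_upwards [hinf.eventually_ge_atTop t] with n hn
    rw [← hl1 n, hl n, abs_sub_comm, abs_of_nonneg (sub_nonneg.2 hn), hl1 n]
  have hmain : Tendsto (fun n : ℕ => dist (l n t) (γ n) - n) (hyperfilter ℕ : Filter ℕ)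
      (𝓝 (busemannF γ p - t)) := by
    refine ((hγ.tendsto_busemannF_nat p).sub_const t).congr' ?_
    filter_upwards [heq] with n hn
    rw [hn]
    ring
  refine tendsto_nhds_unique (hγ.tendsto_busemannF_nat (σ t)) ?_
  have hdiff : Tendsto (fun n : ℕ => dist (σ t) (γ n) - dist (l n t) (γ n))
      (hyperfilter ℕ : Filter ℕ) (𝓝 0) := by
    refine squeeze_zero_norm (fun n => ?_) hd
    rw [Real.norm_eq_abs, dist_comm (l n t) (σ t)]
    exact abs_dist_sub_le _ _ _
  have := hdiff.add hmain
  rw [zero_add] at this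
  exact this.congr fun n => by ring

/-- Busemann functions are differentiable along geodesic lines. -/
lemma differentiableAt_busemannF_comp (hM : IsHadamard M) (hlower : SecGEneg4 M) {γ c : ℝ → M}
    (hγ : IsUnitSpeedGeodesic γ) (hc : IsUnitSpeedGeodesic c) :
    DifferentiableAt ℝ (fun s => busemannF γ (c s)) 0 := by
  obtain ⟨-, σ, -, -, -, hσ, hσ0, -, hσγ⟩ := exists_asymptotic_line hM hγ (c 0)
  rw [← hσ0] at hσγ
  refine (hγ.convexOn_busemannF hM hc).differentiableAt_zero_of_add_neg_le (C := 4) fun s => ?_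
  have hconv := (hσ.reverse.convexOn_busemannF hM hc).2 (Set.mem_univ s) (Set.mem_univ (-s))
    (by norm_num : (0 : ℝ) ≤ 1 / 2) (by norm_num : (0 : ℝ) ≤ 1 / 2) (by norm_num)
  simp only [smul_eq_mul] at hconv
  rw [show 1 / 2 * s + 1 / 2 * -s = 0 by ring] at hconv
  have hq := fun r : ℝ => hσ.busemannF_add_reverse_le hlower (c r) 0
  simp only [hσ0, hc _ 0, sub_zero, sq_abs] at hq
  have hub := fun r : ℝ => hγ.busemannF_le_of_asymptotic hσ hσγ (c r)
  simp only [hσ0] at hub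
  have h0 := hσ.busemannF_add_reverse_nonneg (c 0)
  have h0' : busemannF σ (c 0) ≤ 0 := by
    have := hσ.busemannF_le (c 0) 0
    rw [hσ0, dist_self] at this
    linarith
  have h1 := hq s
  have h2 := hq (-s)
  have h3 := hub s
  have h4 := hub (-s)
  change busemannF γ (c s) + busemannF γ (c (-s)) ≤ 2 * busemannF γ (c 0) + 4 * s ^ 2
  nlinarith

/-- If a Busemann function attains its minimum along a line `c` at `c 0`, then it grows along `c`
at least as in the hyperbolic plane. -/
lemma add_log_cosh_le_busemannF (hM : IsHadamard M) (hupper : SecLEneg1 M) (hlower : SecGEneg4 M)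
    {γ c : ℝ → M} (hγ : IsUnitSpeedGeodesic γ) (hc : IsUnitSpeedGeodesic c)
    (hmin : ∀ s, busemannF γ (c 0) ≤ busemannF γ (c s)) {s : ℝ} (hs : 0 ≤ s) :
    busemannF γ (c 0) + Real.log (Real.cosh s) ≤ busemannF γ (c s) := by
  obtain ⟨l, σ, hl, hl0, hl1, hσ, hσ0, hlim, hσγ⟩ := exists_asymptotic_line hM hγ (c 0)
  rw [← hσ0] at hσγ
  have hq := fun r : ℝ => hσ.busemannF_add_reverse_le hlower (c r) 0
  simp only [hσ0, hc _ 0, sub_zero, sq_abs] at hq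
  have hpos : ∀ r, 0 ≤ busemannF σ (c r) := by
    intro r
    have h1 := hγ.busemannF_le_of_asymptotic hσ hσγ (c r)
    rw [hσ0] at h1
    linarith [hmin r]
  have hconv := hσ.reverse.convexOn_busemannF hM hc
  have hrev0 : busemannF (fun t => σ (-t)) (c 0) = 0 := by
    have h1 := hσ.reverse.busemannF_le (c 0) 0
    rw [neg_zero, hσ0, dist_self] at h1
    have h2 := hσ.busemannF_le (c 0) 0
    rw [hσ0, dist_self] at h2
    linarith [hσ.busemannF_add_reverse_nonneg (c 0)]
  have hneg : ∀ r, 0 ≤ busemannF (fun t => σ (-t)) (c r) := by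
    refine hconv.nonneg_of_neg_sq_le hrev0 (C := 2) fun r => ?_
    have h1 := hconv.2 (Set.mem_univ r) (Set.mem_univ (-r))
      (by norm_num : (0 : ℝ) ≤ 1 / 2) (by norm_num : (0 : ℝ) ≤ 1 / 2) (by norm_num)
    simp only [smul_eq_mul] at h1
    rw [show 1 / 2 * r + 1 / 2 * -r = 0 by ring, hrev0] at h1
    have h2 := hq (-r)
    have h3 := hpos (-r)
    change -(2 * r ^ 2) ≤ busemannF (fun t => σ (-t)) (c r)
    nlinarith
  have hdist : ∀ r τ, |τ| ≤ dist (σ τ) (c r) := by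
    intro r τ
    rw [dist_comm]
    refine abs_le'.2 ⟨?_, ?_⟩
    · linarith [hσ.busemannF_le (c r) τ, hpos r]
    · have h1 := hσ.reverse.busemannF_le (c r) (-τ)
      rw [neg_neg] at h1
      linarith [hneg r]
  have hστ : ∀ τ, dist (σ τ) (c 0) = |τ| := fun τ => by rw [← hσ0, hσ, sub_zero]
  have hlow : ∀ τ, s + Real.log (Real.cosh τ) ≤ dist (c s) (σ τ) := by
    intro τ
    have h1 := (hupper c hc (σ τ) 0 (IsUnitSpeedGeodesic.dist_eq_infDist_of_forall_le
      fun t => by rw [hστ]; exact hdist t τ)).1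
    rw [hστ, Real.cosh_abs, neg_zero, zero_add] at h1
    have h2 := hc.busemannF_le (σ τ) s
    rw [dist_comm] at h2
    linarith
  choose u hu using fun n => (hl n).exists_foot (c s)
  have hv : ∀ n, dist (c s) (l n (u n)) ≤ s := by
    intro n
    rw [hu n]
    refine (infDist_le_dist_of_mem (Set.mem_range_self 0)).trans ?_
    rw [hl0, hc, sub_zero, abs_of_nonneg hs]
  have humem : closedBall (0 : ℝ) (2 * s) ∈ (hyperfilter ℕ).map u := by
    refine Ultrafilter.mem_map.2 (Filter.univ_mem' fun n => ?_)
    change dist (u n) 0 ≤ 2 * s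
    have h1 := dist_triangle_left (l n (u n)) (l n 0) (c s)
    rw [hl n, hl0, hc s 0, sub_zero, sub_zero, abs_of_nonneg hs] at h1
    rw [Real.dist_eq, sub_zero]
    linarith [hv n]
  obtain ⟨w, -, hw⟩ := (isCompact_closedBall (0 : ℝ) (2 * s)).ultrafilter_le_nhds' _ humem
  replace hw : Tendsto u (hyperfilter ℕ : Filter ℕ) (𝓝 w) := hw
  have hfoot : Tendsto (fun n => l n (u n)) (hyperfilter ℕ : Filter ℕ) (𝓝 (σ w)) := by
    rw [tendsto_iff_dist_tendsto_zero]
    have h1 := (tendsto_iff_dist_tendsto_zero.1 hw).add (tendsto_iff_dist_tendsto_zero.1 (hlim w))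
    rw [add_zero] at h1
    refine squeeze_zero (fun _ => dist_nonneg) (fun n => ?_) h1
    refine (dist_triangle _ (l n w) _).trans ?_
    rw [hl n, Real.dist_eq]
  have hvlim : Tendsto (fun n => dist (c s) (l n (u n))) (hyperfilter ℕ : Filter ℕ)
      (𝓝 (dist (c s) (σ w))) := tendsto_const_nhds.dist hfoot
  have hw0 : w = 0 := by
    by_contra hne
    have h1 := le_of_tendsto' hvlim hv
    linarith [hlow w, log_cosh_pos hne]
  subst hw0
  rw [hσ0, hc, sub_zero, abs_of_nonneg hs] at hvlim
  have hbound : ∀ n : ℕ, -u n + Real.log (Real.cosh (dist (c s) (l n (u n)))) ≤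
      (dist (c s) (γ n) - n) - (dist (c 0) (γ n) - n) := by
    intro n
    have h1 := (hupper (l n) (hl n) (c s) (u n) (hu n)).1
    have h2 := (hl n).busemannF_le (c s) (dist (c 0) (γ n))
    rw [hl1] at h2
    linarith
  have := le_of_tendsto_of_tendsto'
    (hw.neg.add ((continuous_log_cosh.tendsto s).comp hvlim))
    ((hγ.tendsto_busemannF_nat (c s)).sub (hγ.tendsto_busemannF_nat (c 0))) hbound
  linarith

/-- If `p` is far from `γ`, then some line from `p` asymptotic to `γ` does not leave the
horoball at the opposite end of `γ` for a definite time. -/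
lemma exists_asymptotic_line_busemannF_reverse_le (hM : IsHadamard M) (hupper : SecLEneg1 M)
    {γ : ℝ → M} (hγ : IsUnitSpeedGeodesic γ) {p : M}
    (hp : Real.log 2 < busemannF γ p + busemannF (fun t => γ (-t)) p) :
    ∃ (l : ℝ → M) (δ : ℝ), 0 < δ ∧ IsUnitSpeedGeodesic l ∧ l 0 = p ∧
      (∀ t, busemannF γ (l t) = busemannF γ p - t) ∧
      busemannF (fun t => γ (-t)) (l δ) ≤ busemannF (fun t => γ (-t)) p := by
  obtain ⟨l, σ, hl, hl0, hl1, hσ, hσ0, hlim, hσγ⟩ := exists_asymptotic_line hM hγ p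
  set f := busemannF (fun t => γ (-t)) with hf
  set δ := (busemannF γ p + f p - Real.log 2) / 2 with hδ
  have hδ0 : 0 < δ := by rw [hδ]; linarith
  refine ⟨σ, δ, hδ0, hσ, hσ0, hσγ, ?_⟩
  refine le_of_tendsto' ((hγ.reverse.continuous_busemannF.tendsto _).comp (hlim δ)) fun n => ?_
  refine ge_of_tendsto (hγ.reverse.tendsto_busemannF p) ?_
  filter_upwards [eventually_ge_atTop 0] with t ht
  obtain ⟨w, hw⟩ := (hl n).exists_foot (γ (-t))
  have h1 := (hupper (l n) (hl n) _ w hw).1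
  have h2 := (hl n).busemannF_le (γ (-t)) (dist p (γ n))
  have hn : (0 : ℝ) ≤ n := n.cast_nonneg
  rw [hl1, hγ, abs_sub_comm, abs_of_nonneg (by linarith)] at h2
  have h3 := hγ.busemannF_le p n
  have h4 := sub_log_two_le_log_cosh (dist (γ (-t)) (l n w))
  have h5 := hγ.reverse.busemannF_le (l n w) t
  rw [dist_comm] at h5
  have h6 := hγ.reverse.busemannF_le_add_dist p (l n w)
  rw [← hl0 n, hl n, hl0 n, zero_sub, abs_neg] at h6
  rw [← hf] at h5 h6
  have hwδ : δ ≤ w := by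
    rcases le_total w 0 with hw0 | hw0
    · rw [abs_of_nonpos hw0] at h6
      linarith
    · rw [abs_of_nonneg hw0] at h6
      linarith
  have h7 : dist (γ (-t)) (l n w) ≤ dist p (γ (-t)) := by
    rw [hw, dist_comm p, ← hl0 n]
    exact infDist_le_dist_of_mem (Set.mem_range_self 0)
  have h8 := hγ.reverse.busemannF_le p t
  have h9 := (hγ.reverse.convexOn_busemannF hM (hl n)).le_max_of_mem_Icc (Set.mem_univ 0)
    (Set.mem_univ w) ⟨hδ0.le, hwδ⟩
  refine h9.trans (max_le ?_ ?_)
  · simpa only [hl0] using h8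
  · change f (l n w) ≤ _
    linarith

lemma isUnitSpeedGeodesic_concat {γ c l : ℝ → M} (hγ : IsUnitSpeedGeodesic γ)
    (hc : IsUnitSpeedGeodesic c) (hl : IsUnitSpeedGeodesic l) (h0 : c 0 = l 0)
    (hcγ : ∀ t, busemannF γ (c t) = busemannF γ (c 0) - t)
    (hlγ : ∀ t, busemannF γ (l t) = busemannF γ (l 0) - t) :
    IsUnitSpeedGeodesic fun t => if t ≤ 0 then c t else l t := by
  have key : ∀ s t : ℝ, s ≤ 0 → 0 ≤ t → dist (c s) (l t) = |s - t| := by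
    intro s t hs ht
    rw [abs_of_nonpos (by linarith)]
    refine le_antisymm ?_ ?_
    · have := dist_triangle (c s) (c 0) (l t)
      rw [hc s 0, h0, hl 0 t, abs_of_nonpos (by linarith), abs_of_nonpos (by linarith)] at this
      linarith
    · have := hγ.busemannF_le_add_dist (c s) (l t)
      rw [hcγ, hlγ, h0] at this
      linarith
  intro s t
  by_cases hs : s ≤ 0 <;> by_cases ht : t ≤ 0
  · simpa only [if_pos hs, if_pos ht] using hc s t
  · simpa only [if_pos hs, if_neg ht] using key s t hs (not_le.1 ht).le
  · simpa only [if_neg hs, if_pos ht, dist_comm, abs_sub_comm] using key t s ht (not_le.1 hs).le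
  · simpa only [if_neg hs, if_neg ht] using hl s t

end Busemann

/-- in a Cartan–Hadamard space with pinched curvature
`−4 ≤ κ ≤ −1`, for any `t₀` and any `T ≥ (1/2) log 2`, at every point `p` of
the horosphere `{f_γ = −t₀ + T}` lying outside the horoball
`{f_{−γ} ≤ t₀ + T}` one has `⟨∇f_γ(p), ∇f_{−γ}(p)⟩ > 0`.

Since `−∇f_γ(p)` is the initial velocity of the unit-speed geodesic ray `c`
from `p` asymptotic to `γ(+∞)` (characterized by `f_γ(c(s)) = f_γ(p) − s`),
the gradient inequality is expressed metrically as: the derivative at `s = 0`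
of `s ↦ f_{−γ}(c(s))` along any such ray is negative. -/
theorem busemann_gradients_acute (M : Type*) [MetricSpace M]
    (hM : IsHadamard M) (hupper : SecLEneg1 M) (hlower : SecGEneg4 M)
    (γ : ℝ → M) (hγ : IsUnitSpeedGeodesic γ)
    (t₀ T : ℝ) (hT : (1 / 2) * Real.log 2 ≤ T) (p : M)
    (hp₁ : busemannF γ p = -t₀ + T)
    (hp₂ : t₀ + T < busemannF (fun t => γ (-t)) p) :
    ∀ c : ℝ → M, IsUnitSpeedGeodesic c → c 0 = p →
      (∀ s : ℝ, busemannF γ (c s) = busemannF γ p - s) →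
      deriv (fun s => busemannF (fun t => γ (-t)) (c s)) 0 < 0 := by
  intro c hc hc0 hcγ
  have hγ' := hγ.reverse
  obtain ⟨l, δ, hδ, hl, hl0, hlγ, hlδ⟩ :=
    exists_asymptotic_line_busemannF_reverse_le hM hupper hγ (p := p) (by linarith)
  rw [← hl0] at hlγ hlδ
  have hb := isUnitSpeedGeodesic_concat hγ hc hl (hc0.trans hl0.symm) (by rwa [hc0]) hlγ
  have hdc := (differentiableAt_busemannF_comp hM hlower hγ' hc).hasDerivAt
  have hdl := (differentiableAt_busemannF_comp hM hlower hγ' hl).hasDerivAt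
  have hdb := (differentiableAt_busemannF_comp hM hlower hγ' hb).hasDerivAt
  have hleft := (uniqueDiffWithinAt_Iic (0 : ℝ)).eq_deriv _ hdc.hasDerivWithinAt
    (hdb.hasDerivWithinAt.congr (fun t ht => by rw [if_pos (Set.mem_Iic.1 ht)]) (by simp))
  have hright := (uniqueDiffWithinAt_Ici (0 : ℝ)).eq_deriv _ hdl.hasDerivWithinAt
    (hdb.hasDerivWithinAt.congr (fun t ht => by
      rcases (Set.mem_Ici.1 ht).eq_or_lt with rfl | h
      · simp [hc0, hl0]
      · rw [if_neg (not_le.2 h)]) (by simp [hc0, hl0]))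
  rw [hleft, ← hright]
  have hsupp := (hγ'.convexOn_busemannF hM hl).add_mul_le_of_hasDerivAt_zero hdl
  refine lt_of_le_of_ne ?_ fun h0 => ?_
  · have := hsupp δ
    exact nonpos_of_mul_nonpos_left (by linarith) hδ
  · have := add_log_cosh_le_busemannF hM hupper hlower hγ' hl
      (fun s => by simpa [h0] using hsupp s) hδ.le
    linarith [log_cosh_pos hδ.ne']
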